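/- arXiv:2503.13219 — 2 statements merged into one kernel-verified Lean document; each statement's English description precedes it below -/
import Mathlib

section
/- Let γ: [0,T)×[-1,1] → ℝⁿ be a fixed-length free-boundary elastic flow (FLFB-EF). Then for every t ∈ [0,T): d/dt E(γ(t,·)) = −∫_{-1}^{1} |∂_tγ|² ds ≤ 0; in particular E(γ(t,·)) ≤ E(γ(0,·)) for all t, and ∫_0^T ∫_{-1}^{1} |∂_tγ|² ds dt ≤ E(γ(0,·)). -/
open Set MeasureTheory Filter
open scoped RealInnerProductSpace

noncomputable section

variable {n : ℕ}

/-- Arc-length derivative along the curve `g` of a field `f`. -/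
def aderiv {F : Type*} [NormedAddCommGroup F] [NormedSpace ℝ F]
    (g : ℝ → EuclideanSpace ℝ (Fin n)) (f : ℝ → F) : ℝ → F :=
  fun x => ‖deriv g x‖⁻¹ • deriv f x

/-- Unit tangent `∂ₛγ`. -/
def utang (g : ℝ → EuclideanSpace ℝ (Fin n)) : ℝ → EuclideanSpace ℝ (Fin n) :=
  aderiv g g

/-- Normal projection along `g`. -/
def nperp (g f : ℝ → EuclideanSpace ℝ (Fin n)) : ℝ → EuclideanSpace ℝ (Fin n) :=
  fun x => f x - ⟪f x, utang g x⟫ • utang g x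

/-- Curvature vector `κ = ∂ₛ²γ`. -/
def curvV (g : ℝ → EuclideanSpace ℝ (Fin n)) : ℝ → EuclideanSpace ℝ (Fin n) :=
  aderiv g (utang g)

/-- Projected arc-length derivative `∂ₛ^⊥`. -/
def aderivP (g f : ℝ → EuclideanSpace ℝ (Fin n)) : ℝ → EuclideanSpace ℝ (Fin n) :=
  nperp g (aderiv g f)

/-- Iterated projected arc-length derivative `(∂ₛ^⊥)^k`. -/
def aderivPIter (g : ℝ → EuclideanSpace ℝ (Fin n)) :
    ℕ → (ℝ → EuclideanSpace ℝ (Fin n)) → ℝ → EuclideanSpace ℝ (Fin n)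
  | 0, f => f
  | k + 1, f => aderivP g (aderivPIter g k f)

/-- Iterated full arc-length derivative `∂ₛ^k`. -/
def aderivIter (g : ℝ → EuclideanSpace ℝ (Fin n)) :
    ℕ → (ℝ → EuclideanSpace ℝ (Fin n)) → ℝ → EuclideanSpace ℝ (Fin n)
  | 0, f => f
  | k + 1, f => aderiv g (aderivIter g k f)

/-- Elastic energy `E(γ) = ∫ |κ|² ds`. -/
def elE (g : ℝ → EuclideanSpace ℝ (Fin n)) : ℝ :=
  ∫ x in (-1:ℝ)..1, ‖curvV g x‖ ^ 2 * ‖deriv g x‖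

/-- Length `L(γ) = ∫ ds`. -/
def elL (g : ℝ → EuclideanSpace ℝ (Fin n)) : ℝ :=
  ∫ x in (-1:ℝ)..1, ‖deriv g x‖

/-- Energy gradient `∇E(γ) = 2(∂ₛ^⊥)²κ + |κ|²κ`. -/
def gradElE (g : ℝ → EuclideanSpace ℝ (Fin n)) : ℝ → EuclideanSpace ℝ (Fin n) :=
  fun x => (2:ℝ) • aderivPIter g 2 (curvV g) x + ‖curvV g x‖ ^ 2 • curvV g x

/-- Lagrange multiplier `λ(γ)`. -/
def lagMul (g : ℝ → EuclideanSpace ℝ (Fin n)) : ℝ :=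
  (∫ x in (-1:ℝ)..1, ⟪gradElE g x, curvV g x⟫ * ‖deriv g x‖) / elE g

/-- Time derivative `∂ₜγ` of a family. -/
def timeD (γ : ℝ → ℝ → EuclideanSpace ℝ (Fin n)) : ℝ → ℝ → EuclideanSpace ℝ (Fin n) :=
  fun t x => deriv (fun s => γ s x) t

/-- Tangential speed `φ = ⟨∂ₜγ, ∂ₛγ⟩`. -/
def tanSpeed (γ : ℝ → ℝ → EuclideanSpace ℝ (Fin n)) : ℝ → ℝ → ℝ :=
  fun t x => ⟪timeD γ t x, utang (γ t) x⟫

/-- Normal velocity `V = ∂ₜγ − φ ∂ₛγ`. -/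
def normalVel (γ : ℝ → ℝ → EuclideanSpace ℝ (Fin n)) : ℝ → ℝ → EuclideanSpace ℝ (Fin n) :=
  fun t x => timeD γ t x - tanSpeed γ t x • utang (γ t) x

/-- Normal time derivative `∂ₜ^⊥N` of a field along the family γ. -/
def timeDPerp (γ N : ℝ → ℝ → EuclideanSpace ℝ (Fin n)) : ℝ → ℝ → EuclideanSpace ℝ (Fin n) :=
  fun t x => deriv (fun s => N s x) t
    - ⟪deriv (fun s => N s x) t, utang (γ t) x⟫ • utang (γ t) x

/-- Shape operator `S_p = −Dξ(p)`. -/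
def shapeOp (ξ : EuclideanSpace ℝ (Fin n) → EuclideanSpace ℝ (Fin n))
    (p v : EuclideanSpace ℝ (Fin n)) : EuclideanSpace ℝ (Fin n) :=
  -(fderiv ℝ ξ p v)

/-- `L²(ds)` norm of a field along `g`. -/
def l2ds (g f : ℝ → EuclideanSpace ℝ (Fin n)) : ℝ :=
  Real.sqrt (∫ x in (-1:ℝ)..1, ‖f x‖ ^ 2 * ‖deriv g x‖)

/-- Fixed-length free-boundary elastic flow on `[0,T)`. -/
def IsFLFBEF (T : ℝ) (ξ : EuclideanSpace ℝ (Fin n) → EuclideanSpace ℝ (Fin n))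
    (τ : ℝ → ℝ) (γ : ℝ → ℝ → EuclideanSpace ℝ (Fin n)) : Prop :=
  ContDiff ℝ (⊤ : ℕ∞) (fun p : ℝ × ℝ => γ p.1 p.2) ∧
  (∀ t ∈ Ico (0:ℝ) T, ∀ x ∈ Icc (-1:ℝ) 1, deriv (γ t) x ≠ 0) ∧
  (∀ t ∈ Ico (0:ℝ) T, 0 < elE (γ t)) ∧
  (∀ t ∈ Ico (0:ℝ) T, ∀ x ∈ Icc (-1:ℝ) 1,
    timeD γ t x = -(gradElE (γ t) x - lagMul (γ t) • curvV (γ t) x)) ∧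
  (∀ t ∈ Ico (0:ℝ) T, ∀ x ∈ ({-1, 1} : Set ℝ),
    ⟪timeD γ t x, utang (γ t) x⟫ = 0 ∧
    utang (γ t) x = τ x • ξ (γ t x) ∧
    ‖ξ (γ t x)‖ = 1 ∧
    aderivP (γ t) (curvV (γ t)) x = -(τ x • shapeOp ξ (γ t x) (curvV (γ t) x)))


section helpers
open Topology

lemma hd_x {F : Type*} [NormedAddCommGroup F] [NormedSpace ℝ F] {U : Set (ℝ × ℝ)} (hU : IsOpen U)
    {f : ℝ × ℝ → F} (hf : ContDiffOn ℝ (⊤ : ℕ∞) f U) {t x : ℝ} (hp : (t, x) ∈ U) :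
    HasDerivAt (fun y => f (t, y)) (fderiv ℝ f (t, x) (0, 1)) x := by
  have h1 : HasFDerivAt f (fderiv ℝ f (t, x)) (t, x) :=
    ((hf.contDiffAt (hU.mem_nhds hp)).differentiableAt (by simp)).hasFDerivAt
  exact h1.comp_hasDerivAt x ((hasDerivAt_const x t).prodMk (hasDerivAt_id x))

lemma hd_t {F : Type*} [NormedAddCommGroup F] [NormedSpace ℝ F] {U : Set (ℝ × ℝ)} (hU : IsOpen U)
    {f : ℝ × ℝ → F} (hf : ContDiffOn ℝ (⊤ : ℕ∞) f U) {t x : ℝ} (hp : (t, x) ∈ U) :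
    HasDerivAt (fun s => f (s, x)) (fderiv ℝ f (t, x) (1, 0)) t := by
  have h1 : HasFDerivAt f (fderiv ℝ f (t, x)) (t, x) :=
    ((hf.contDiffAt (hU.mem_nhds hp)).differentiableAt (by simp)).hasFDerivAt
  exact h1.comp_hasDerivAt t ((hasDerivAt_id t).prodMk (hasDerivAt_const t x))

lemma cd_fd {F : Type*} [NormedAddCommGroup F] [NormedSpace ℝ F] {U : Set (ℝ × ℝ)} (hU : IsOpen U)
    {f : ℝ × ℝ → F} (hf : ContDiffOn ℝ (⊤ : ℕ∞) f U) (v : ℝ × ℝ) :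
    ContDiffOn ℝ (⊤ : ℕ∞) (fun p => fderiv ℝ f p v) U :=
  (hf.fderiv_of_isOpen hU (by simp)).clm_apply contDiffOn_const

lemma cd_x {F : Type*} [NormedAddCommGroup F] [NormedSpace ℝ F] {U : Set (ℝ × ℝ)} (hU : IsOpen U)
    {f : ℝ × ℝ → F} (hf : ContDiffOn ℝ (⊤ : ℕ∞) f U) :
    ContDiffOn ℝ (⊤ : ℕ∞) (fun p => deriv (fun y => f (p.1, y)) p.2) U :=
  (cd_fd hU hf (0, 1)).congr fun p hp => (hd_x hU hf (t := p.1) (x := p.2) hp).deriv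

lemma cd_t {F : Type*} [NormedAddCommGroup F] [NormedSpace ℝ F] {U : Set (ℝ × ℝ)} (hU : IsOpen U)
    {f : ℝ × ℝ → F} (hf : ContDiffOn ℝ (⊤ : ℕ∞) f U) :
    ContDiffOn ℝ (⊤ : ℕ∞) (fun p => deriv (fun s => f (s, p.2)) p.1) U :=
  (cd_fd hU hf (1, 0)).congr fun p hp => (hd_t hU hf (t := p.1) (x := p.2) hp).deriv

lemma h_x {F : Type*} [NormedAddCommGroup F] [NormedSpace ℝ F] {U : Set (ℝ × ℝ)} (hU : IsOpen U)
    {f : ℝ × ℝ → F} (hf : ContDiffOn ℝ (⊤ : ℕ∞) f U) {t x : ℝ} (hp : (t, x) ∈ U) :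
    HasDerivAt (fun y => f (t, y)) (deriv (fun y => f (t, y)) x) x :=
  (hd_x hU hf hp).differentiableAt.hasDerivAt

lemma h_t {F : Type*} [NormedAddCommGroup F] [NormedSpace ℝ F] {U : Set (ℝ × ℝ)} (hU : IsOpen U)
    {f : ℝ × ℝ → F} (hf : ContDiffOn ℝ (⊤ : ℕ∞) f U) {t x : ℝ} (hp : (t, x) ∈ U) :
    HasDerivAt (fun s => f (s, x)) (deriv (fun s => f (s, x)) t) t :=
  (hd_t hU hf hp).differentiableAt.hasDerivAt

/-- Mixed partial derivatives commute. -/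
lemma mixed {F : Type*} [NormedAddCommGroup F] [NormedSpace ℝ F] {U : Set (ℝ × ℝ)} (hU : IsOpen U)
    {f : ℝ × ℝ → F} (hf : ContDiffOn ℝ (⊤ : ℕ∞) f U) {t x : ℝ} (hp : (t, x) ∈ U) :
    deriv (fun s => deriv (fun y => f (s, y)) x) t
      = deriv (fun y => deriv (fun s => f (s, y)) t) x := by
  have hsm := (hf.contDiffAt (hU.mem_nhds hp)).isSymmSndFDerivAt
    (by simp; exact WithTop.coe_le_coe.2 (le_top : (2 : ℕ∞) ≤ ⊤))
  have hdd : DifferentiableAt ℝ (fderiv ℝ f) (t, x) :=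
    ((hf.fderiv_of_isOpen (m := (⊤ : ℕ∞)) hU (by simp)).contDiffAt
      (hU.mem_nhds hp)).differentiableAt (by simp)
  have e1 : (fun s => deriv (fun y => f (s, y)) x) =ᶠ[𝓝 t]
      fun s => fderiv ℝ f (s, x) (0, 1) := by
    have : ContinuousAt (fun s : ℝ => (s, x)) t := by fun_prop
    filter_upwards [this.preimage_mem_nhds (hU.mem_nhds hp)] with s hs
    exact (hd_x hU hf hs).deriv
  have e2 : (fun y => deriv (fun s => f (s, y)) t) =ᶠ[𝓝 x]
      fun y => fderiv ℝ f (t, y) (1, 0) := by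
    have : ContinuousAt (fun y : ℝ => (t, y)) x := by fun_prop
    filter_upwards [this.preimage_mem_nhds (hU.mem_nhds hp)] with s hs
    exact (hd_t hU hf hs).deriv
  rw [e1.deriv_eq, e2.deriv_eq]
  rw [(hd_t hU (cd_fd hU hf (0, 1)) hp).deriv, (hd_x hU (cd_fd hU hf (1, 0)) hp).deriv]
  have key : ∀ v w : ℝ × ℝ, fderiv ℝ (fun p => fderiv ℝ f p v) (t, x) w
      = fderiv ℝ (fderiv ℝ f) (t, x) w v := by
    intro v w
    rw [fderiv_clm_apply hdd (by fun_prop)]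
    simp
  rw [key, key]
  exact hsm _ _

/-- Differentiation under the integral sign. -/
lemma param_deriv {U : Set (ℝ × ℝ)} (hU : IsOpen U)
    {f : ℝ × ℝ → ℝ} (hf : ContDiffOn ℝ (⊤ : ℕ∞) f U) {t : ℝ}
    (ht : ∀ x ∈ Icc (-1:ℝ) 1, (t, x) ∈ U) :
    HasDerivAt (fun s => ∫ x in (-1:ℝ)..1, f (s, x))
      (∫ x in (-1:ℝ)..1, deriv (fun s => f (s, x)) t) t := by
  obtain ⟨u, v, hu, hv, htu, hIv, huv⟩ := generalized_tube_lemma (s := {t})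
    isCompact_singleton (t := Icc (-1:ℝ) 1) isCompact_Icc hU (by
      rintro ⟨a, b⟩ ⟨ha, hb⟩
      simp only [mem_singleton_iff] at ha
      subst ha
      exact ht b hb)
  obtain ⟨ε, hε, hball⟩ := Metric.nhds_basis_closedBall.mem_iff.1 (hu.mem_nhds (htu rfl))
  have hsub : Metric.closedBall t ε ×ˢ Icc (-1:ℝ) 1 ⊆ U :=
    (prod_mono hball hIv).trans huv
  have hcomp : IsCompact (Metric.closedBall t ε ×ˢ Icc (-1:ℝ) 1) :=
    (isCompact_closedBall t ε).prod isCompact_Icc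
  obtain ⟨C, hC⟩ := hcomp.exists_bound_of_continuousOn ((cd_t hU hf).continuousOn.mono hsub)
  have hcont : ∀ {g : ℝ × ℝ → ℝ}, ContinuousOn g U → ∀ s ∈ Metric.closedBall t ε,
      ContinuousOn (fun x => g (s, x)) (Icc (-1:ℝ) 1) := by
    intro g hg s hs
    exact hg.comp (by fun_prop) (fun x hx => hsub ⟨hs, hx⟩)
  have hI : uIoc (-1:ℝ) 1 ⊆ Icc (-1) 1 := by
    rw [uIoc_of_le (by norm_num)]; exact Ioc_subset_Icc_self
  have htt : t ∈ Metric.closedBall t ε := Metric.mem_closedBall_self hε.le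
  refine (intervalIntegral.hasDerivAt_integral_of_dominated_loc_of_deriv_le
    (F := fun s x => f (s, x)) (F' := fun s x => deriv (fun s => f (s, x)) s)
    (bound := fun _ => C) (Metric.closedBall_mem_nhds t hε) ?_ ?_ ?_ ?_ ?_ ?_).2
  · filter_upwards [Metric.closedBall_mem_nhds t hε] with s hs
    exact ((hcont hf.continuousOn s hs).mono hI).aestronglyMeasurable measurableSet_uIoc
  · apply ContinuousOn.intervalIntegrable
    rw [uIcc_of_le (by norm_num)]
    exact hcont hf.continuousOn t htt
  · exact ((hcont (cd_t hU hf).continuousOn t htt).mono hI).aestronglyMeasurable measurableSet_uIoc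
  · exact Eventually.of_forall fun x hx s hs => hC (s, x) ⟨hs, hI hx⟩
  · simp
  · exact Eventually.of_forall fun x hx s hs => h_t hU hf (hsub ⟨hs, hI hx⟩)

/-- Pointwise algebra for the first variation. -/
lemma alg {E : Type*} [NormedAddCommGroup E] [InnerProductSpace ℝ E]
    {V Vx T K Kx Kt N Nx P Px P2 Q S : E} {R Rt l : ℝ}
    (h1 : Vx = R • N + Rt • T) (h2 : Nx = R • Kt + Rt • K)
    (hTT : ⟪T, T⟫ = 1) (hNT : ⟪N, T⟫ = 0) (hVT : ⟪V, T⟫ = 0)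
    (hP : P = Q - ⟪Q, T⟫ • T) (hKx : Kx = R • Q) (hP2 : P2 = S - ⟪S, T⟫ • T) (hPx : Px = R • S)
    (hV : V = -(((2:ℝ) • P2 + ‖K‖ ^ 2 • K) - l • K)) :
    2 * ⟪K, Kt⟫ * R + ‖K‖ ^ 2 * Rt =
      (2 * (⟪K, Nx⟫ + ⟪Kx, N⟫) - 2 * (⟪P, Vx⟫ + ⟪Px, V⟫)
        - (2 * ⟪K, Kx⟫ * ⟪V, T⟫ + ‖K‖ ^ 2 * (⟪V, R • K⟫ + ⟪Vx, T⟫)))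
      + (-(‖V‖ ^ 2 * R) + l * (⟪K, V⟫ * R)) := by
  have hPT : ⟪P, T⟫ = 0 := by
    rw [hP, inner_sub_left, inner_smul_left, hTT]; simp
  have hPN : ⟪P, N⟫ = ⟪Q, N⟫ := by
    rw [hP, inner_sub_left, inner_smul_left, real_inner_comm, real_inner_comm N T, hNT,
      real_inner_comm]; simp
  have hP2V : ⟪P2, V⟫ = ⟪S, V⟫ := by
    rw [hP2, inner_sub_left, inner_smul_left, real_inner_comm V T, hVT]; simp
  have hVV : ‖V‖ ^ 2 = -(2 * ⟪S, V⟫ + ‖K‖ ^ 2 * ⟪K, V⟫ - l * ⟪K, V⟫) := by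
    rw [← real_inner_self_eq_norm_sq]
    nth_rewrite 1 [hV]
    rw [inner_neg_left, inner_sub_left, inner_add_left, inner_smul_left, inner_smul_left,
      inner_smul_left, hP2V]
    simp
  rw [hVV, h1, h2, hKx, hPx, hVT]
  simp only [inner_add_right, inner_add_left, real_inner_smul_left, real_inner_smul_right,
    hPT, hPN, hTT, hNT, real_inner_self_eq_norm_sq]
  rw [real_inner_comm V K]
  ring


section flow
variable {γ : ℝ → ℝ → EuclideanSpace ℝ (Fin n)}

/-- The set of regular points. -/
def regSet (γ : ℝ → ℝ → EuclideanSpace ℝ (Fin n)) : Set (ℝ × ℝ) := {p | deriv (γ p.1) p.2 ≠ 0}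

lemma sm_gx (h : ContDiff ℝ (⊤ : ℕ∞) (fun p : ℝ × ℝ => γ p.1 p.2)) :
    ContDiff ℝ (⊤ : ℕ∞) (fun p : ℝ × ℝ => deriv (γ p.1) p.2) :=
  contDiffOn_univ.1 (cd_x isOpen_univ (contDiffOn_univ.2 h))

lemma sm_v (h : ContDiff ℝ (⊤ : ℕ∞) (fun p : ℝ × ℝ => γ p.1 p.2)) :
    ContDiff ℝ (⊤ : ℕ∞) (fun p : ℝ × ℝ => timeD γ p.1 p.2) :=
  contDiffOn_univ.1 (cd_t isOpen_univ (contDiffOn_univ.2 h))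

lemma open_reg (h : ContDiff ℝ (⊤ : ℕ∞) (fun p : ℝ × ℝ => γ p.1 p.2)) : IsOpen (regSet γ) :=
  isOpen_ne.preimage (sm_gx h).continuous

lemma sm_r (h : ContDiff ℝ (⊤ : ℕ∞) (fun p : ℝ × ℝ => γ p.1 p.2)) :
    ContDiffOn ℝ (⊤ : ℕ∞) (fun p : ℝ × ℝ => ‖deriv (γ p.1) p.2‖) (regSet γ) :=
  (sm_gx h).contDiffOn.norm ℝ fun _ hp => hp

lemma sm_ad (h : ContDiff ℝ (⊤ : ℕ∞) (fun p : ℝ × ℝ => γ p.1 p.2))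
    {f : ℝ → ℝ → EuclideanSpace ℝ (Fin n)}
    (hf : ContDiffOn ℝ (⊤ : ℕ∞) (fun p : ℝ × ℝ => f p.1 p.2) (regSet γ)) :
    ContDiffOn ℝ (⊤ : ℕ∞) (fun p : ℝ × ℝ => aderiv (γ p.1) (f p.1) p.2) (regSet γ) :=
  ((sm_r h).inv fun _ hp => norm_ne_zero_iff.2 hp).smul (cd_x (open_reg h) hf)

lemma sm_T (h : ContDiff ℝ (⊤ : ℕ∞) (fun p : ℝ × ℝ => γ p.1 p.2)) :
    ContDiffOn ℝ (⊤ : ℕ∞) (fun p : ℝ × ℝ => utang (γ p.1) p.2) (regSet γ) :=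
  sm_ad h (f := γ) h.contDiffOn

lemma sm_adP (h : ContDiff ℝ (⊤ : ℕ∞) (fun p : ℝ × ℝ => γ p.1 p.2))
    {f : ℝ → ℝ → EuclideanSpace ℝ (Fin n)}
    (hf : ContDiffOn ℝ (⊤ : ℕ∞) (fun p : ℝ × ℝ => f p.1 p.2) (regSet γ)) :
    ContDiffOn ℝ (⊤ : ℕ∞) (fun p : ℝ × ℝ => aderivP (γ p.1) (f p.1) p.2) (regSet γ) :=
  (sm_ad h hf).sub (((sm_ad h hf).inner ℝ (sm_T h)).smul (sm_T h))

lemma sm_K (h : ContDiff ℝ (⊤ : ℕ∞) (fun p : ℝ × ℝ => γ p.1 p.2)) :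
    ContDiffOn ℝ (⊤ : ℕ∞) (fun p : ℝ × ℝ => curvV (γ p.1) p.2) (regSet γ) :=
  sm_ad h (f := fun t => utang (γ t)) (sm_T h)

lemma sm_P (h : ContDiff ℝ (⊤ : ℕ∞) (fun p : ℝ × ℝ => γ p.1 p.2)) :
    ContDiffOn ℝ (⊤ : ℕ∞) (fun p : ℝ × ℝ => aderivP (γ p.1) (curvV (γ p.1)) p.2) (regSet γ) :=
  sm_adP h (f := fun t => curvV (γ t)) (sm_K h)

lemma sm_grad (h : ContDiff ℝ (⊤ : ℕ∞) (fun p : ℝ × ℝ => γ p.1 p.2)) :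
    ContDiffOn ℝ (⊤ : ℕ∞) (fun p : ℝ × ℝ => gradElE (γ p.1) p.2) (regSet γ) :=
  ((contDiffOn_const (c := (2:ℝ))).smul (sm_adP h (f := fun t => aderivP (γ t) (curvV (γ t))) (sm_P h))).add
    (((sm_K h).norm_sq ℝ).smul (sm_K h))

lemma aderiv_eq (g : ℝ → EuclideanSpace ℝ (Fin n)) (f : ℝ → EuclideanSpace ℝ (Fin n)) {x : ℝ}
    (hx : deriv g x ≠ 0) : deriv f x = ‖deriv g x‖ • aderiv g f x := by
  rw [aderiv, smul_smul, mul_inv_cancel₀ (norm_ne_zero_iff.2 hx), one_smul]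

lemma utang_unit (g : ℝ → EuclideanSpace ℝ (Fin n)) {x : ℝ}
    (hx : deriv g x ≠ 0) : ⟪utang g x, utang g x⟫ = 1 := by
  have := norm_ne_zero_iff.2 hx
  rw [utang, aderiv, real_inner_smul_left, real_inner_smul_right, real_inner_self_eq_norm_sq]
  field_simp

lemma inner_zero_of_unit {E : Type*} [NormedAddCommGroup E] [InnerProductSpace ℝ E]
    {f : ℝ → E} {f' : E} {x : ℝ} (hf : HasDerivAt f f' x)
    (h : ∀ᶠ y in 𝓝 x, ⟪f y, f y⟫ = 1) : ⟪f', f x⟫ = 0 := by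
  have h1 := hf.inner ℝ hf
  have h2 : HasDerivAt (fun y => ⟪f y, f y⟫) 0 x :=
    (hasDerivAt_const x (1:ℝ)).congr_of_eventuallyEq h
  have h3 := h1.unique h2
  rw [real_inner_comm] at h3
  linarith

lemma ev_x {U : Set (ℝ × ℝ)} (hU : IsOpen U) {t x : ℝ} (hp : (t, x) ∈ U) :
    ∀ᶠ y in 𝓝 x, (t, y) ∈ U := by
  have : ContinuousAt (fun y : ℝ => (t, y)) x := by fun_prop
  exact this.preimage_mem_nhds (hU.mem_nhds hp)

lemma ev_t {U : Set (ℝ × ℝ)} (hU : IsOpen U) {t x : ℝ} (hp : (t, x) ∈ U) :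
    ∀ᶠ s in 𝓝 t, (s, x) ∈ U := by
  have : ContinuousAt (fun s : ℝ => (s, x)) t := by fun_prop
  exact this.preimage_mem_nhds (hU.mem_nhds hp)

lemma nperp_inner (g f : ℝ → EuclideanSpace ℝ (Fin n)) {x : ℝ}
    (hx : deriv g x ≠ 0) : ⟪nperp g f x, utang g x⟫ = 0 := by
  rw [nperp, inner_sub_left, real_inner_smul_left, utang_unit g hx]; ring

lemma curv_inner (h : ContDiff ℝ (⊤ : ℕ∞) (fun p : ℝ × ℝ => γ p.1 p.2)) {t x : ℝ}
    (hp : (t, x) ∈ regSet γ) : ⟪curvV (γ t) x, utang (γ t) x⟫ = 0 := by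
  have h1 := inner_zero_of_unit (h_x (open_reg h) (sm_T h) hp)
    ((ev_x (open_reg h) hp).mono fun y hy => utang_unit _ hy)
  rw [curvV, aderiv, real_inner_smul_left]
  simp only at h1
  change _ * ⟪deriv (fun y => utang (γ t) y) x, _⟫ = 0
  rw [h1, mul_zero]

/-- The boundary term. -/
def bdTerm (γ : ℝ → ℝ → EuclideanSpace ℝ (Fin n)) (t x : ℝ) : ℝ :=
  2 * ⟪curvV (γ t) x, deriv (fun s => utang (γ s) x) t⟫
    - 2 * ⟪aderivP (γ t) (curvV (γ t)) x, timeD γ t x⟫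
    - ‖curvV (γ t) x‖ ^ 2 * ⟪timeD γ t x, utang (γ t) x⟫

/-- Pointwise first variation. -/
lemma pointwise (h : ContDiff ℝ (⊤ : ℕ∞) (fun p : ℝ × ℝ => γ p.1 p.2)) {t x l : ℝ}
    (hp : (t, x) ∈ regSet γ)
    (hV : timeD γ t x = -(gradElE (γ t) x - l • curvV (γ t) x)) :
    HasDerivAt (bdTerm γ t)
      (deriv (fun s => ‖curvV (γ s) x‖ ^ 2 * ‖deriv (γ s) x‖) t
        - (-(‖timeD γ t x‖ ^ 2 * ‖deriv (γ t) x‖)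
          + l * (⟪curvV (γ t) x, timeD γ t x⟫ * ‖deriv (γ t) x‖))) x := by
  have hU := open_reg h
  have hne : deriv (γ t) x ≠ 0 := hp
  have Tt := h_t hU (sm_T h) hp
  have Tx := h_x hU (sm_T h) hp
  have Kt := h_t hU (sm_K h) hp
  have Kx := h_x hU (sm_K h) hp
  have Nx := h_x hU (cd_t hU (sm_T h)) hp
  have Px := h_x hU (sm_P h) hp
  have Vx := h_x hU (sm_v h).contDiffOn hp
  have Rt := h_t hU (sm_r h) hp
  simp only at Tt Tx Kt Kx Nx Px Vx Rt
  have hVT : ⟪timeD γ t x, utang (γ t) x⟫ = 0 := by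
    rw [hV, inner_neg_left, inner_sub_left, gradElE, inner_add_left, real_inner_smul_left,
      real_inner_smul_left, real_inner_smul_left, curv_inner h hp]
    have : ⟪aderivPIter (γ t) 2 (curvV (γ t)) x, utang (γ t) x⟫ = 0 := nperp_inner _ _ hne
    rw [this]; ring
  have hNT := inner_zero_of_unit Tt ((ev_t hU hp).mono fun y hy => utang_unit _ hy)
  -- derivative of the velocity
  have h1 : deriv (fun y => timeD γ t y) x =
      ‖deriv (γ t) x‖ • deriv (fun s => utang (γ s) x) t
        + deriv (fun s => ‖deriv (γ s) x‖) t • utang (γ t) x := by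
    have e := mixed isOpen_univ (contDiffOn_univ.2 h) (mem_univ (t, x))
    have e' : deriv (fun y => timeD γ t y) x = deriv (fun s => deriv (γ s) x) t := e.symm
    rw [e']
    have e2 : (fun s => deriv (γ s) x) =ᶠ[𝓝 t] fun s => ‖deriv (γ s) x‖ • utang (γ s) x :=
      (ev_t hU hp).mono fun s hs => aderiv_eq (γ s) (γ s) hs
    rw [e2.deriv_eq]
    exact (Rt.smul Tt).deriv
  have h2 : deriv (fun y => deriv (fun s => utang (γ s) y) t) x =
      ‖deriv (γ t) x‖ • deriv (fun s => curvV (γ s) x) t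
        + deriv (fun s => ‖deriv (γ s) x‖) t • curvV (γ t) x := by
    have e := mixed hU (sm_T h) hp
    simp only at e
    rw [← e]
    have e2 : (fun s => deriv (fun y => utang (γ s) y) x) =ᶠ[𝓝 t]
        fun s => ‖deriv (γ s) x‖ • curvV (γ s) x :=
      (ev_t hU hp).mono fun s hs => aderiv_eq (γ s) (utang (γ s)) hs
    rw [e2.deriv_eq]
    exact (Rt.smul Kt).deriv
  have hD : deriv (fun s => ‖curvV (γ s) x‖ ^ 2 * ‖deriv (γ s) x‖) t =
      2 * ⟪curvV (γ t) x, deriv (fun s => curvV (γ s) x) t⟫ * ‖deriv (γ t) x‖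
        + ‖curvV (γ t) x‖ ^ 2 * deriv (fun s => ‖deriv (γ s) x‖) t :=
    (Kt.norm_sq.mul Rt).deriv
  have key := alg h1 h2 (utang_unit (γ t) hne) hNT hVT (P := aderivP (γ t) (curvV (γ t)) x) rfl
    (aderiv_eq (γ t) (curvV (γ t)) hne) (P2 := aderivPIter (γ t) 2 (curvV (γ t)) x) rfl
    (aderiv_eq (γ t) (aderivP (γ t) (curvV (γ t))) hne) hV
  rw [hD, key, add_sub_cancel_right]
  have hTx : deriv (fun y => utang (γ t) y) x = ‖deriv (γ t) x‖ • curvV (γ t) x :=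
    aderiv_eq (γ t) (utang (γ t)) hne
  rw [hTx] at Tx
  exact ((Kx.inner ℝ Nx).const_mul 2).sub ((Px.inner ℝ Vx).const_mul 2) |>.sub
    (Kx.norm_sq.mul (Vx.inner ℝ Tx))

lemma slice_cont {F : Type*} [NormedAddCommGroup F] {U : Set (ℝ × ℝ)} {f : ℝ × ℝ → F} {t : ℝ}
    (hf : ContinuousOn f U) (ht : ∀ x ∈ Icc (-1:ℝ) 1, (t, x) ∈ U) :
    IntervalIntegrable (fun x => f (t, x)) volume (-1) 1 := by
  apply ContinuousOn.intervalIntegrable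
  rw [uIcc_of_le (by norm_num)]
  exact hf.comp (by fun_prop) ht

/-- Energy identity. -/
lemma energy_deriv {T : ℝ} {ξ : EuclideanSpace ℝ (Fin n) → EuclideanSpace ℝ (Fin n)}
    (hξ : ContDiff ℝ (⊤ : ℕ∞) ξ)
    (hsym : ∀ p v w : EuclideanSpace ℝ (Fin n),
      ⟪fderiv ℝ ξ p v, w⟫ = ⟪v, fderiv ℝ ξ p w⟫)
    {τ : ℝ → ℝ} (hflow : IsFLFBEF T ξ τ γ) {t : ℝ} (ht : t ∈ Ico (0:ℝ) T) :
    HasDerivAt (fun s => elE (γ s))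
      (-(∫ x in (-1:ℝ)..1, ‖timeD γ t x‖ ^ 2 * ‖deriv (γ t) x‖)) t := by
  obtain ⟨h, hreg, hpos, heq, hbc⟩ := hflow
  have hU := open_reg h
  have hR : ∀ x ∈ Icc (-1:ℝ) 1, (t, x) ∈ regSet γ := fun x hx => hreg t ht x hx
  have smD : ContDiffOn ℝ (⊤ : ℕ∞)
      (fun p : ℝ × ℝ => ‖curvV (γ p.1) p.2‖ ^ 2 * ‖deriv (γ p.1) p.2‖) (regSet γ) :=
    ((sm_K h).norm_sq ℝ).mul (sm_r h)
  have hder := param_deriv hU smD hR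
  simp only at hder
  obtain ⟨l, hl⟩ : ∃ l, l = lagMul (γ t) := ⟨_, rfl⟩
  have cV : ContinuousOn (fun p : ℝ × ℝ => timeD γ p.1 p.2) (regSet γ) :=
    (sm_v h).continuous.continuousOn
  have i1 : IntervalIntegrable (fun x => deriv (fun s => ‖curvV (γ s) x‖ ^ 2 * ‖deriv (γ s) x‖) t)
      volume (-1) 1 := slice_cont (cd_t hU smD).continuousOn hR
  have i2 : IntervalIntegrable (fun x => ‖timeD γ t x‖ ^ 2 * ‖deriv (γ t) x‖) volume (-1) 1 :=
    slice_cont ((cV.norm.pow 2).mul (sm_r h).continuousOn) hR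
  have i2n : IntervalIntegrable (fun x => -(‖timeD γ t x‖ ^ 2 * ‖deriv (γ t) x‖))
      volume (-1) 1 := i2.neg
  have i3 : IntervalIntegrable (fun x => ⟪curvV (γ t) x, timeD γ t x⟫ * ‖deriv (γ t) x‖)
      volume (-1) 1 :=
    slice_cont (((sm_K h).continuousOn.inner cV).mul (sm_r h).continuousOn) hR
  have i4 : IntervalIntegrable (fun x => ⟪gradElE (γ t) x, curvV (γ t) x⟫ * ‖deriv (γ t) x‖)
      volume (-1) 1 :=
    slice_cont (((sm_grad h).continuousOn.inner (sm_K h).continuousOn).mul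
      (sm_r h).continuousOn) hR
  have i5 : IntervalIntegrable (fun x => ‖curvV (γ t) x‖ ^ 2 * ‖deriv (γ t) x‖) volume (-1) 1 :=
    slice_cont smD.continuousOn hR
  have hIcc : uIcc (-1:ℝ) 1 = Icc (-1) 1 := uIcc_of_le (by norm_num)
  have hFTC := intervalIntegral.integral_eq_sub_of_hasDerivAt (a := -1) (b := 1)
    (fun x hx => pointwise h (l := l) (hR x (hIcc ▸ hx)) (hl ▸ heq t ht x (hIcc ▸ hx)))
    (i1.sub (i2n.add (i3.const_mul l)))
  rw [intervalIntegral.integral_sub i1 (i2n.add (i3.const_mul l)),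
    intervalIntegral.integral_add i2n (i3.const_mul l), intervalIntegral.integral_neg,
    intervalIntegral.integral_const_mul] at hFTC
  have hz : ∫ x in (-1:ℝ)..1, ⟪curvV (γ t) x, timeD γ t x⟫ * ‖deriv (γ t) x‖ = 0 := by
    have e : ∫ x in (-1:ℝ)..1, ⟪curvV (γ t) x, timeD γ t x⟫ * ‖deriv (γ t) x‖ =
        ∫ x in (-1:ℝ)..1, (l * (‖curvV (γ t) x‖ ^ 2 * ‖deriv (γ t) x‖)
          - ⟪gradElE (γ t) x, curvV (γ t) x⟫ * ‖deriv (γ t) x‖) := by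
      apply intervalIntegral.integral_congr
      intro x hx
      simp only
      rw [heq t ht x (hIcc ▸ hx), ← hl, inner_neg_right, inner_sub_right, real_inner_smul_right,
        real_inner_self_eq_norm_sq, real_inner_comm (gradElE (γ t) x)]
      ring
    rw [e, intervalIntegral.integral_sub (i5.const_mul l) i4, intervalIntegral.integral_const_mul]
    have hE : (∫ x in (-1:ℝ)..1, ‖curvV (γ t) x‖ ^ 2 * ‖deriv (γ t) x‖) = elE (γ t) := rfl
    rw [hE, hl, lagMul, div_mul_cancel₀ _ (hpos t ht).ne', sub_self]
  have hb : ∀ x ∈ ({-1, 1} : Set ℝ), bdTerm γ t x = 0 := by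
    intro x hx
    have hxI : x ∈ Icc (-1:ℝ) 1 := by
      rcases hx with rfl | hx
      · norm_num
      · rw [mem_singleton_iff.1 hx]; norm_num
    obtain ⟨b1, b2, b3, b4⟩ := hbc t ht x hx
    have Tt := h_t hU (sm_T h) (hR x hxI)
    have Gt := h_t isOpen_univ (contDiffOn_univ.2 h) (mem_univ (t, x))
    simp only at Tt Gt
    have hfd : HasFDerivAt ξ (fderiv ℝ ξ (γ t x)) (γ t x) :=
      (hξ.differentiable (by simp)).differentiableAt.hasFDerivAt
    have Xt : HasDerivAt (fun s => τ x • ξ (γ s x)) (τ x • fderiv ℝ ξ (γ t x) (timeD γ t x)) t :=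
      (hfd.comp_hasDerivAt t Gt).const_smul (τ x)
    have hN : deriv (fun s => utang (γ s) x) t = τ x • fderiv ℝ ξ (γ t x) (timeD γ t x) :=
      (uniqueDiffOn_Ico 0 T t ht).eq_deriv _ Tt.hasDerivWithinAt
        (Xt.hasDerivWithinAt.congr (fun s hs => (hbc s hs x hx).2.1) b2)
    rw [bdTerm, b1, b4, hN, shapeOp, smul_neg, neg_neg, real_inner_smul_left,
      real_inner_smul_right, hsym]
    ring
  rw [hb 1 (by simp), hb (-1) (by simp), hz] at hFTC
  have : -(∫ x in (-1:ℝ)..1, ‖timeD γ t x‖ ^ 2 * ‖deriv (γ t) x‖) =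
      ∫ x in (-1:ℝ)..1, deriv (fun s => ‖curvV (γ s) x‖ ^ 2 * ‖deriv (γ s) x‖) t := by
    linarith
  rw [this]
  exact hder

end flow
end helpers

/-- energy monotonicity along a fixed-length free-boundary elastic flow. -/
theorem statement3
    (n : ℕ) (hn : 2 ≤ n) (T : ℝ) (hT : 0 < T)
    (ξ : EuclideanSpace ℝ (Fin n) → EuclideanSpace ℝ (Fin n))
    (hξ : ContDiff ℝ (⊤ : ℕ∞) ξ)
    (hsym : ∀ p v w : EuclideanSpace ℝ (Fin n),
      ⟪fderiv ℝ ξ p v, w⟫ = ⟪v, fderiv ℝ ξ p w⟫)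
    (hbd : ∀ k : ℕ, ∃ Ck : ℝ, ∀ p, ‖iteratedFDeriv ℝ k ξ p‖ ≤ Ck)
    (τ : ℝ → ℝ) (hτ : ∀ x ∈ ({-1, 1} : Set ℝ), τ x = 1 ∨ τ x = -1)
    (γ : ℝ → ℝ → EuclideanSpace ℝ (Fin n))
    (hflow : IsFLFBEF T ξ τ γ) :
    (∀ t ∈ Ico (0:ℝ) T,
      deriv (fun s => elE (γ s)) t
          = -(∫ x in (-1:ℝ)..1, ‖timeD γ t x‖ ^ 2 * ‖deriv (γ t) x‖) ∧
      deriv (fun s => elE (γ s)) t ≤ 0 ∧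
      elE (γ t) ≤ elE (γ 0)) ∧
    (∫ t in (0:ℝ)..T, ∫ x in (-1:ℝ)..1, ‖timeD γ t x‖ ^ 2 * ‖deriv (γ t) x‖)
      ≤ elE (γ 0) := by
  have hd := fun t (ht : t ∈ Ico (0:ℝ) T) => energy_deriv hξ hsym hflow ht
  have h := hflow.1
  have hpos := hflow.2.2.1
  have hcont : Continuous
      (fun t => ∫ x in (-1:ℝ)..1, ‖timeD γ t x‖ ^ 2 * ‖deriv (γ t) x‖) := by
    apply intervalIntegral.continuous_parametric_intervalIntegral_of_continuous'
    exact ((sm_v h).continuous.norm.pow 2).mul (sm_gx h).continuous.norm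
  set Ψ := fun t => ∫ x in (-1:ℝ)..1, ‖timeD γ t x‖ ^ 2 * ‖deriv (γ t) x‖ with hΨ
  have hΨ0 : ∀ t, 0 ≤ Ψ t := fun t =>
    intervalIntegral.integral_nonneg (by norm_num) fun x _ => by positivity
  have hint : ∀ b ∈ Ico (0:ℝ) T, ∫ t in (0:ℝ)..b, Ψ t = elE (γ 0) - elE (γ b) := by
    intro b hb
    have := intervalIntegral.integral_eq_sub_of_hasDerivAt (a := 0) (b := b)
      (f := fun s => elE (γ s)) (f' := fun t => -Ψ t)
      (fun t ht => hd t (by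
        rw [uIcc_of_le hb.1] at ht
        exact ⟨ht.1, ht.2.trans_lt hb.2⟩)) (hcont.neg.intervalIntegrable 0 b)
    rw [intervalIntegral.integral_neg] at this
    linarith
  refine ⟨fun t ht => ⟨(hd t ht).deriv, ?_, ?_⟩, ?_⟩
  · rw [(hd t ht).deriv]
    exact neg_nonpos.2 (hΨ0 t)
  · have h1 := hint t ht
    have h2 : 0 ≤ ∫ s in (0:ℝ)..t, Ψ s :=
      intervalIntegral.integral_nonneg ht.1 fun s _ => hΨ0 s
    linarith
  · have hc : Continuous fun b => ∫ t in (0:ℝ)..b, Ψ t :=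
      intervalIntegral.continuous_primitive (fun a b => hcont.intervalIntegrable a b) 0
    have hlim := (hc.tendsto T).mono_left (nhdsWithin_le_nhds (s := Iio T))
    refine le_of_tendsto hlim ?_
    filter_upwards [Ico_mem_nhdsLT hT] with b hb
    rw [hint b hb]
    linarith [hpos b hb]

end
end

section
/- For every n ≥ 2, m ∈ ℕ₀, L₀ > 0 and δ > 0 there exists a constant C = C(L₀, δ, n, m) > 0 such that: every smooth immersion γ: [-1,1] → ℝⁿ with L(γ) = L₀ and δ < E(γ) < δ⁻¹ satisfies |λ(γ)| ≤ C ( 1 + ‖(∂_s^⊥)^{m+2}κ‖_{L²(ds)}^{2/(m+2)} ), where ‖Φ‖_{L²(ds)} = ( ∫_{-1}^{1} |Φ|² ds )^{1/2}. -/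
open Set MeasureTheory Filter
open scoped RealInnerProductSpace

noncomputable section

variable {n : ℕ}

lemma ax_int {f : ℝ → ℝ} (hf : ContinuousOn f (Icc (-1:ℝ) 1)) :
    IntervalIntegrable f volume (-1) 1 := by
  apply ContinuousOn.intervalIntegrable
  rwa [uIcc_of_le (by norm_num)]

/-- Weighted Cauchy–Schwarz. -/
lemma ax_cs {v f g : ℝ → ℝ} (hv : ContinuousOn v (Icc (-1:ℝ) 1))
    (hv0 : ∀ x ∈ Icc (-1:ℝ) 1, 0 ≤ v x)
    (hf : ContinuousOn f (Icc (-1:ℝ) 1)) (hg : ContinuousOn g (Icc (-1:ℝ) 1)) :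
    ∫ x in (-1:ℝ)..1, f x * g x * v x ≤
      Real.sqrt (∫ x in (-1:ℝ)..1, f x ^ 2 * v x) * Real.sqrt (∫ x in (-1:ℝ)..1, g x ^ 2 * v x) := by
  set A := ∫ x in (-1:ℝ)..1, f x ^ 2 * v x with hA
  set B := ∫ x in (-1:ℝ)..1, f x * g x * v x with hB
  set C := ∫ x in (-1:ℝ)..1, g x ^ 2 * v x with hC
  have iA : IntervalIntegrable (fun x => f x ^ 2 * v x) volume (-1) 1 := ax_int (by fun_prop)
  have iB : IntervalIntegrable (fun x => f x * g x * v x) volume (-1) 1 := ax_int (by fun_prop)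
  have iC : IntervalIntegrable (fun x => g x ^ 2 * v x) volume (-1) 1 := ax_int (by fun_prop)
  have hA0 : 0 ≤ A := intervalIntegral.integral_nonneg (by norm_num)
    (fun x hx => mul_nonneg (sq_nonneg _) (hv0 x hx))
  have key : ∀ t : ℝ, 0 ≤ C * (t * t) + (2 * B) * t + A := by
    intro t
    have h0 : 0 ≤ ∫ x in (-1:ℝ)..1, (t * g x + f x) ^ 2 * v x :=
      intervalIntegral.integral_nonneg (by norm_num)
        (fun x hx => mul_nonneg (sq_nonneg _) (hv0 x hx))
    have h1 : ∫ x in (-1:ℝ)..1, (t * g x + f x) ^ 2 * v x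
        = C * (t * t) + (2 * B) * t + A := by
      rw [hA, hB, hC]
      have : (fun x => (t * g x + f x) ^ 2 * v x) = fun x =>
        ((t * t) * (g x ^ 2 * v x) + (2 * t) * (f x * g x * v x)) + f x ^ 2 * v x := by
        funext x; ring
      rw [this, intervalIntegral.integral_add ((iC.const_mul _).add (iB.const_mul _)) iA,
        intervalIntegral.integral_add (iC.const_mul _) (iB.const_mul _),
        intervalIntegral.integral_const_mul, intervalIntegral.integral_const_mul]
      ring
    linarith
  have hd := discrim_le_zero key
  unfold discrim at hd
  rw [← Real.sqrt_mul hA0]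
  apply Real.le_sqrt_of_sq_le
  nlinarith

/-- Weighted L² norm. -/
def axN {F : Type*} [NormedAddCommGroup F] (v : ℝ → ℝ) (f : ℝ → F) : ℝ :=
  Real.sqrt (∫ x in (-1:ℝ)..1, ‖f x‖ ^ 2 * v x)

lemma axN_nonneg {F : Type*} [NormedAddCommGroup F] (v : ℝ → ℝ) (f : ℝ → F) : 0 ≤ axN v f :=
  Real.sqrt_nonneg _

lemma axN_sq {F : Type*} [NormedAddCommGroup F] {v : ℝ → ℝ} {f : ℝ → F}
    (hv0 : ∀ x ∈ Icc (-1:ℝ) 1, 0 ≤ v x) :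
    axN v f ^ 2 = ∫ x in (-1:ℝ)..1, ‖f x‖ ^ 2 * v x :=
  Real.sq_sqrt (intervalIntegral.integral_nonneg (by norm_num)
    (fun x hx => mul_nonneg (sq_nonneg _) (hv0 x hx)))

section
variable {F : Type*} [NormedAddCommGroup F] [InnerProductSpace ℝ F]

lemma ax_inner {v : ℝ → ℝ} {f g : ℝ → F} (hv : ContinuousOn v (Icc (-1:ℝ) 1))
    (hv0 : ∀ x ∈ Icc (-1:ℝ) 1, 0 ≤ v x)
    (hf : ContinuousOn f (Icc (-1:ℝ) 1)) (hg : ContinuousOn g (Icc (-1:ℝ) 1)) :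
    ∫ x in (-1:ℝ)..1, |⟪f x, g x⟫ * v x| ≤ axN v f * axN v g := by
  refine le_trans ?_ (ax_cs hv hv0 hf.norm hg.norm)
  apply intervalIntegral.integral_mono_on (by norm_num)
  · exact ax_int (ContinuousOn.abs ((hf.inner hg).mul hv))
  · exact ax_int ((hf.norm.mul hg.norm).mul hv)
  · intro x hx
    rw [abs_mul, abs_of_nonneg (hv0 x hx)]
    exact mul_le_mul_of_nonneg_right (abs_real_inner_le_norm _ _) (hv0 x hx)

lemma ax_inner' {v : ℝ → ℝ} {f g : ℝ → F} (hv : ContinuousOn v (Icc (-1:ℝ) 1))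
    (hv0 : ∀ x ∈ Icc (-1:ℝ) 1, 0 ≤ v x)
    (hf : ContinuousOn f (Icc (-1:ℝ) 1)) (hg : ContinuousOn g (Icc (-1:ℝ) 1)) :
    |∫ x in (-1:ℝ)..1, ⟪f x, g x⟫ * v x| ≤ axN v f * axN v g :=
  (intervalIntegral.abs_integral_le_integral_abs (by norm_num)).trans (ax_inner hv hv0 hf hg)

/-- Sup bound. -/
lemma ax_sup {v : ℝ → ℝ} {f g : ℝ → F} {L : ℝ} (hL : 0 < L)
    (hv : ContinuousOn v (Icc (-1:ℝ) 1))
    (hv0 : ∀ x ∈ Icc (-1:ℝ) 1, 0 ≤ v x) (hvL : ∫ x in (-1:ℝ)..1, v x = L)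
    (hf : ContinuousOn f (Icc (-1:ℝ) 1)) (hg : ContinuousOn g (Icc (-1:ℝ) 1))
    (hd : ∀ x ∈ Icc (-1:ℝ) 1, HasDerivAt (fun y => ⟪f y, f y⟫) (2 * (⟪g x, f x⟫ * v x)) x)
    (x : ℝ) (hx : x ∈ Icc (-1:ℝ) 1) :
    ‖f x‖ ^ 2 ≤ L⁻¹ * axN v f ^ 2 + 2 * axN v f * axN v g := by
  have hc : ContinuousOn (fun y => ⟪g y, f y⟫ * v y) (Icc (-1:ℝ) 1) := (hg.inner hf).mul hv
  have step : ∀ y ∈ Icc (-1:ℝ) 1, ‖f x‖ ^ 2 ≤ ‖f y‖ ^ 2 + 2 * axN v f * axN v g := by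
    intro y hy
    have hsub : uIcc y x ⊆ Icc (-1:ℝ) 1 := uIcc_subset_Icc hy hx
    have e := intervalIntegral.integral_eq_sub_of_hasDerivAt
      (fun z hz => hd z (hsub hz))
      (ContinuousOn.intervalIntegrable ((hc.const_smul (2:ℝ)).mono hsub))
    rw [intervalIntegral.integral_const_mul, real_inner_self_eq_norm_sq,
      real_inner_self_eq_norm_sq] at e
    have b : |∫ z in y..x, ⟪g z, f z⟫ * v z| ≤ ∫ z in (-1:ℝ)..1, |⟪g z, f z⟫ * v z| := by
      refine (intervalIntegral.norm_integral_le_abs_integral_norm (f := fun z => ⟪g z, f z⟫ * v z)).trans ?_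
      simp only [Real.norm_eq_abs]
      refine (intervalIntegral.abs_integral_mono_interval (c := -1) (d := 1) ?_ ?_ ?_).trans ?_
      · rw [uIoc_of_le (by norm_num : (-1:ℝ) ≤ 1)]
        intro z hz
        rcases le_total y x with h | h
        · rw [uIoc_of_le h] at hz
          exact ⟨lt_of_le_of_lt hy.1 hz.1, hz.2.trans hx.2⟩
        · rw [uIoc_of_ge h] at hz
          exact ⟨lt_of_le_of_lt hx.1 hz.1, hz.2.trans hy.2⟩
      · exact Eventually.of_forall fun z => abs_nonneg _
      · exact ax_int hc.abs
      · rw [abs_of_nonneg (intervalIntegral.integral_nonneg (by norm_num) fun _ _ => abs_nonneg _)]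
    have b2 := b.trans (ax_inner hv hv0 hg hf)
    have := le_abs_self (∫ z in y..x, ⟪g z, f z⟫ * v z)
    nlinarith
  have h1 : ∫ y in (-1:ℝ)..1, ‖f x‖ ^ 2 * v y ≤
      ∫ y in (-1:ℝ)..1, (‖f y‖ ^ 2 * v y + 2 * axN v f * axN v g * v y) := by
    apply intervalIntegral.integral_mono_on (by norm_num)
    · exact ax_int (by fun_prop)
    · exact ax_int (by fun_prop)
    · intro y hy
      have := mul_le_mul_of_nonneg_right (step y hy) (hv0 y hy)
      linarith
  rw [intervalIntegral.integral_const_mul, intervalIntegral.integral_add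
    (ax_int (by fun_prop)) (ax_int (by fun_prop)), intervalIntegral.integral_const_mul, hvL,
    ← axN_sq hv0] at h1
  have : ‖f x‖ ^ 2 = L⁻¹ * (‖f x‖ ^ 2 * L) := by field_simp
  rw [this]
  have h2 := mul_le_mul_of_nonneg_left h1 (inv_nonneg.2 hL.le)
  refine h2.trans (le_of_eq ?_)
  field_simp

/-- Pure real arithmetic behind the interpolation step. -/
lemma ax_arith {M p q r t u : ℝ} (hM : 0 ≤ M) (hp : 0 ≤ p) (hq : 0 ≤ q) (hr : 0 ≤ r)
    (ht : t ^ 2 ≤ (M * p ^ 2 + 2 * p * q) * (M * q ^ 2 + 2 * q * r))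
    (hu : u ^ 2 ≤ (M * p ^ 2 + 2 * p * q) * (M * q ^ 2 + 2 * q * r))
    (h : q ^ 2 ≤ t + u + p * r) :
    q ^ 2 ≤ (64 * (M + 2) ^ 2) ^ 2 * (p * (p + r)) := by
  obtain ⟨k, hk⟩ : ∃ k, k = 64 * (M + 2) ^ 2 := ⟨_, rfl⟩
  rw [← hk]
  have hk1 : 256 ≤ k := by rw [hk]; nlinarith
  by_contra! hcon
  have hk0 : 0 < k := by linarith
  have hq0 : 0 < q := by
    rcases hq.eq_or_lt with h0 | h0
    · have : 0 ≤ k ^ 2 * (p * (p + r)) := by positivity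
      rw [← h0] at hcon; nlinarith
    · exact h0
  have hpr0 : 0 ≤ p * r := mul_nonneg hp hr
  have h1 : k * p ≤ q := by
    apply abs_le_of_sq_le_sq' _ hq |>.2
    have : 0 ≤ k ^ 2 * (p * r) := by positivity
    nlinarith
  have h2 : k ^ 2 * (p * r) ≤ q ^ 2 := by
    have : 0 ≤ k ^ 2 * (p * p) := by positivity
    nlinarith
  have h2' : k * (p * r) ≤ q ^ 2 := by
    have : 0 ≤ k * (p * r) := by positivity
    nlinarith
  have hpq : p ≤ q := by nlinarith
  have e : (M * p ^ 2 + 2 * p * q) * (M * q ^ 2 + 2 * q * r)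
      = M ^ 2 * p * p * q ^ 2 + 2 * M * (p * r) * (p * q) + 2 * M * p * q ^ 3
        + 4 * (p * r) * q ^ 2 := by ring
  rw [e] at ht hu
  have w1 : k * (M ^ 2 * p * p * q ^ 2) ≤ M ^ 2 * q ^ 4 := by
    have : k * p * p ≤ q * q := mul_le_mul h1 hpq hp hq
    have h3 : 0 ≤ M ^ 2 * q ^ 2 := by positivity
    nlinarith [mul_le_mul_of_nonneg_left this h3]
  have w2 : k * (2 * M * (p * r) * (p * q)) ≤ 2 * M * q ^ 4 := by
    have : k * (p * r) * (p * q) ≤ q ^ 2 * (q * q) :=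
      mul_le_mul h2' (mul_le_mul_of_nonneg_right hpq hq) (by positivity) (by positivity)
    nlinarith [mul_le_mul_of_nonneg_left this hM]
  have w3 : k * (2 * M * p * q ^ 3) ≤ 2 * M * q ^ 4 := by
    have h3 : 0 ≤ 2 * M * q ^ 3 := by positivity
    nlinarith [mul_le_mul_of_nonneg_left h1 h3]
  have w4 : k * (4 * (p * r) * q ^ 2) ≤ 4 * q ^ 4 := by
    have h3 : 0 ≤ 4 * q ^ 2 := by positivity
    nlinarith [mul_le_mul_of_nonneg_left h2' h3]
  have fin : ∀ s : ℝ, s ^ 2 ≤ M ^ 2 * p * p * q ^ 2 + 2 * M * (p * r) * (p * q)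
      + 2 * M * p * q ^ 3 + 4 * (p * r) * q ^ 2 → s ≤ q ^ 2 / 8 := by
    intro s hs
    have h3 : k * s ^ 2 ≤ (M + 2) ^ 2 * q ^ 4 := by
      have := mul_le_mul_of_nonneg_left hs hk0.le
      nlinarith
    have h4 : (M + 2) ^ 2 * (64 * s ^ 2) ≤ (M + 2) ^ 2 * q ^ 4 := by
      rw [hk] at h3; linarith
    have h5 : 64 * s ^ 2 ≤ q ^ 4 := le_of_mul_le_mul_left h4 (by positivity)
    apply (abs_le_of_sq_le_sq' _ (by positivity)).2
    nlinarith
  have f1 := fin t ht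
  have f2 := fin u hu
  have f3 : p * r ≤ q ^ 2 / 256 := by nlinarith
  nlinarith [sq_pos_of_pos hq0]

/-- Interpolation step. -/
lemma ax_step {v : ℝ → ℝ} {f g h : ℝ → F} {L : ℝ} (hL : 0 < L)
    (hv : ContinuousOn v (Icc (-1:ℝ) 1))
    (hv0 : ∀ x ∈ Icc (-1:ℝ) 1, 0 ≤ v x) (hvL : ∫ x in (-1:ℝ)..1, v x = L)
    (hf : ContinuousOn f (Icc (-1:ℝ) 1)) (hg : ContinuousOn g (Icc (-1:ℝ) 1))
    (hh : ContinuousOn h (Icc (-1:ℝ) 1))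
    (hff : ∀ x ∈ Icc (-1:ℝ) 1, HasDerivAt (fun y => ⟪f y, f y⟫) (2 * (⟪g x, f x⟫ * v x)) x)
    (hgg : ∀ x ∈ Icc (-1:ℝ) 1, HasDerivAt (fun y => ⟪g y, g y⟫) (2 * (⟪h x, g x⟫ * v x)) x)
    (hfg : ∀ x ∈ Icc (-1:ℝ) 1, HasDerivAt (fun y => ⟪f y, g y⟫)
      (‖g x‖ ^ 2 * v x + ⟪f x, h x⟫ * v x) x) :
    axN v g ^ 2 ≤ (64 * (L⁻¹ + 2) ^ 2) ^ 2 * (axN v f * (axN v f + axN v h)) := by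
  have s1 := ax_sup hL hv hv0 hvL hf hg hff
  have s2 := ax_sup hL hv hv0 hvL hg hh hgg
  have i1 : IntervalIntegrable (fun x => ‖g x‖ ^ 2 * v x) volume (-1) 1 := ax_int (by fun_prop)
  have i2 : IntervalIntegrable (fun x => ⟪f x, h x⟫ * v x) volume (-1) 1 :=
    ax_int ((hf.inner hh).mul hv)
  have e := intervalIntegral.integral_eq_sub_of_hasDerivAt (a := -1) (b := 1)
    (fun z hz => hfg z (by rwa [uIcc_of_le (by norm_num)] at hz)) (i1.add i2)
  rw [intervalIntegral.integral_add i1 i2, ← axN_sq hv0] at e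
  have a := ax_inner' hv hv0 hf hh
  have m1 : (-1:ℝ) ∈ Icc (-1:ℝ) 1 := by constructor <;> norm_num
  have m2 : (1:ℝ) ∈ Icc (-1:ℝ) 1 := by constructor <;> norm_num
  have bd : ∀ x ∈ Icc (-1:ℝ) 1, (‖f x‖ * ‖g x‖) ^ 2 ≤
      (L⁻¹ * axN v f ^ 2 + 2 * axN v f * axN v g) * (L⁻¹ * axN v g ^ 2 + 2 * axN v g * axN v h) := by
    intro x hx
    rw [mul_pow]
    exact mul_le_mul (s1 x hx) (s2 x hx) (sq_nonneg _) ((sq_nonneg _).trans (s1 x hx))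
  refine ax_arith (inv_nonneg.2 hL.le) (axN_nonneg v f) (axN_nonneg v g) (axN_nonneg v h)
    (bd 1 m2) (bd (-1) m1) ?_
  have n1 := (abs_le.1 (abs_real_inner_le_norm (f 1) (g 1))).2
  have n2 := (abs_le.1 (abs_real_inner_le_norm (f (-1)) (g (-1)))).1
  have n3 := (abs_le.1 a).1
  linarith

end

/-- Discrete interpolation, epsilon form. -/
lemma ax_seq (K : ℝ) (hK : 0 < K) (k : ℕ) : ∀ η : ℝ, 0 < η → ∃ C : ℝ, 0 < C ∧
    ∀ c : ℕ → ℝ, (∀ i, 0 ≤ c i) → (∀ i, c (i+1) ^ 2 ≤ K * (c i * (c i + c (i+2)))) →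
      c k ≤ η * c (k+1) + C * c 0 := by
  induction k with
  | zero =>
    intro η hη
    refine ⟨1, one_pos, fun c hc _ => ?_⟩
    have := mul_nonneg hη.le (hc 1)
    simp only [zero_add]; linarith
  | succ k ih =>
    intro η hη
    -- c_{k+1} ≤ η/2 c_{k+2} + M c_k
    obtain ⟨M, hM0, hM⟩ : ∃ M : ℝ, 0 < M ∧ K ≤ M ^ 2 ∧ K ≤ η * M := by
      refine ⟨K + 1 + K / η, by positivity, ?_, ?_⟩
      · have : 0 < K / η := by positivity
        nlinarith
      · have : η * (K / η) = K := by field_simp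
        nlinarith
    obtain ⟨C, hC, h⟩ := ih (1 / (2 * M)) (by positivity)
    refine ⟨2 * M * C, by positivity, fun c hc hi => ?_⟩
    have h1 := h c hc hi
    have h2 := hi k
    have h3 : c (k+1) ≤ η / 2 * c (k+2) + M * c k := by
      have p0 := hc k
      have p2 := hc (k+2)
      apply (abs_le_of_sq_le_sq' _ (by positivity)).2
      have q1 := mul_le_mul_of_nonneg_right hM.1 (mul_nonneg p0 p0)
      have q2 := mul_le_mul_of_nonneg_right hM.2 (mul_nonneg p0 p2)
      nlinarith [sq_nonneg (η / 2 * c (k+2))]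
    have h4 := mul_le_mul_of_nonneg_left h1 hM0.le
    have h5 : M * (1 / (2 * M) * c (k+1) + C * c 0) = c (k+1) / 2 + M * C * c 0 := by
      field_simp
    rw [h5] at h4
    have : k + 1 + 1 = k + 2 := rfl
    rw [this]
    linarith

lemma ax_seq2 (K : ℝ) (hK : 0 < K) (i d : ℕ) : ∃ C : ℝ, 0 < C ∧
    ∀ c : ℕ → ℝ, (∀ i, 0 ≤ c i) → (∀ i, c (i+1) ^ 2 ≤ K * (c i * (c i + c (i+2)))) →
      c i ≤ C * (c 0 + c (i+d)) := by
  induction d with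
  | zero =>
    refine ⟨1, one_pos, fun c hc _ => ?_⟩
    have := hc 0
    simp only [add_zero]; linarith
  | succ d ih =>
    obtain ⟨C, hC, h⟩ := ih
    obtain ⟨C', hC', h'⟩ := ax_seq K hK (i+d) 1 one_pos
    refine ⟨C * (1 + C'), by positivity, fun c hc hi => ?_⟩
    have h1 := h c hc hi
    have h2 := h' c hc hi
    have h3 : c (i + d) ≤ c (i + (d+1)) + C' * c 0 := by
      rw [← add_assoc]; linarith
    have h4 := mul_le_mul_of_nonneg_left h3 hC.le
    have := mul_nonneg (mul_nonneg hC.le hC'.le) (hc (i + (d+1)))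
    nlinarith

/-- Scaled interpolation. -/
lemma ax_interp (K : ℝ) (hK : 0 < K) (m : ℕ) : ∃ C : ℝ, 0 < C ∧
    ∀ b : ℕ → ℝ, (∀ i, 0 ≤ b i) → (∀ i, b (i+1) ^ 2 ≤ K * (b i * (b i + b (i+2)))) →
      b 1 ≤ C * (b 0 + 1) * (1 + b (m+2) ^ ((2:ℝ) / (m+2))) ∧
      b 2 ≤ C * (b 0 + 1) * (1 + b (m+2) ^ ((2:ℝ) / (m+2))) := by
  obtain ⟨C1, hC1, h1⟩ := ax_seq2 K hK 1 (m+1)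
  obtain ⟨C2, hC2, h2⟩ := ax_seq2 K hK 2 m
  refine ⟨C1 + C2, by positivity, fun b hb hi => ?_⟩
  set B := max 1 (b (m+2)) with hB
  have hB1 : 1 ≤ B := le_max_left _ _
  have hB0 : 0 < B := by linarith
  set P := B ^ ((1:ℝ) / (m+2)) with hP
  have hP1 : 1 ≤ P := Real.one_le_rpow hB1 (by positivity)
  have hP0 : 0 < P := by linarith
  have hPk : P ^ (m+2) = B := by
    rw [hP, ← Real.rpow_natCast, ← Real.rpow_mul hB0.le]
    push_cast
    rw [one_div_mul_cancel (by positivity), Real.rpow_one]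
  have hP2 : P ^ 2 ≤ 1 + b (m+2) ^ ((2:ℝ) / (m+2)) := by
    have e : P ^ 2 = B ^ ((2:ℝ) / (m+2)) := by
      rw [hP, ← Real.rpow_natCast, ← Real.rpow_mul hB0.le]
      congr 1
      push_cast; ring
    rw [e]
    have := Real.rpow_nonneg (hb (m+2)) ((2:ℝ) / (m+2))
    rcases max_choice 1 (b (m+2)) with h | h
    · rw [hB, h, Real.one_rpow]; linarith
    · rw [hB, h]; linarith
  set c : ℕ → ℝ := fun i => (P⁻¹) ^ i * b i with hc
  have hε0 : 0 < P⁻¹ := by positivity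
  have hε1 : P⁻¹ ≤ 1 := inv_le_one_of_one_le₀ hP1
  have hc0 : ∀ i, 0 ≤ c i := fun i => mul_nonneg (by positivity) (hb i)
  have hci : ∀ i, c (i+1) ^ 2 ≤ K * (c i * (c i + c (i+2))) := by
    intro i
    have a1 := mul_le_mul_of_nonneg_left (hi i) (by positivity : 0 ≤ (P⁻¹) ^ (2*i+2))
    have a2 : (P⁻¹) ^ (2*i+2) ≤ (P⁻¹) ^ (2*i) :=
      pow_le_pow_of_le_one hε0.le hε1 (by omega)
    have a3 := mul_le_mul_of_nonneg_right a2 (mul_nonneg hK.le (mul_nonneg (hb i) (hb i)))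
    have e1 : c (i+1) ^ 2 = (P⁻¹) ^ (2*i+2) * b (i+1) ^ 2 := by simp only [hc]; ring
    have e2 : K * (c i * (c i + c (i+2))) = (P⁻¹) ^ (2*i) * (K * (b i * b i))
        + (P⁻¹) ^ (2*i+2) * (K * (b i * b (i+2))) := by simp only [hc]; ring
    rw [e1, e2]
    linarith
  have r1 := h1 c hc0 hci
  have r2 := h2 c hc0 hci
  have hck : c (m+2) ≤ 1 := by
    simp only [hc]
    rw [inv_pow, hPk, inv_mul_le_iff₀ hB0, mul_one]
    exact le_max_right _ _
  have e0 : c 0 = b 0 := by simp [hc]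
  have e1 : b 1 = P * c 1 := by simp only [hc]; field_simp
  have e2 : b 2 = P ^ 2 * c 2 := by simp only [hc]; field_simp
  rw [show 1 + (m+1) = m+2 by ring, e0] at r1
  rw [show 2 + m = m+2 by ring, e0] at r2
  have hb0 := hb 0
  have r1' : c 1 ≤ (C1 + C2) * (b 0 + 1) := by nlinarith
  have r2' : c 2 ≤ (C1 + C2) * (b 0 + 1) := by nlinarith
  have hX : 0 ≤ (C1 + C2) * (b 0 + 1) := by positivity
  have hPP : P ≤ P ^ 2 := by nlinarith
  constructor
  · rw [e1, mul_comm P]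
    exact mul_le_mul r1' (hPP.trans hP2) hP0.le hX
  · rw [e2, mul_comm (P ^ 2)]
    exact mul_le_mul r2' hP2 (by positivity) hX

section
variable {γ : ℝ → EuclideanSpace ℝ (Fin n)}

lemma ax_deriv {F : Type*} [NormedAddCommGroup F] [NormedSpace ℝ F] {f : ℝ → F} {x : ℝ}
    (hf : ContDiffAt ℝ (⊤ : ℕ∞) f x) : ContDiffAt ℝ (⊤ : ℕ∞) (deriv f) x := by
  have h : ContDiffAt ℝ (⊤ : ℕ∞) (fderiv ℝ f) x := hf.fderiv_right (by simp)
  have : deriv f = fun y => fderiv ℝ f y 1 := by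
    funext y; simp
  rw [this]
  exact h.clm_apply contDiffAt_const

/-- Smooth where `γ` is immersed. -/
def axS (γ f : ℝ → EuclideanSpace ℝ (Fin n)) : Prop :=
  ∀ x, deriv γ x ≠ 0 → ContDiffAt ℝ (⊤ : ℕ∞) f x

/-- Normal where `γ` is immersed. -/
def axNor (γ f : ℝ → EuclideanSpace ℝ (Fin n)) : Prop :=
  ∀ x, deriv γ x ≠ 0 → ⟪f x, utang γ x⟫ = 0

lemma ax_S_aderiv (hγ : ContDiff ℝ (⊤ : ℕ∞) γ) {f : ℝ → EuclideanSpace ℝ (Fin n)}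
    (hf : axS γ f) : axS γ (aderiv γ f) := by
  intro x hx
  unfold aderiv
  have h1 : ContDiffAt ℝ (⊤ : ℕ∞) (fun y => ‖deriv γ y‖) x :=
    (ax_deriv hγ.contDiffAt).norm ℝ hx
  exact (h1.inv (norm_ne_zero_iff.2 hx)).smul (ax_deriv (hf x hx))

lemma ax_S_utang (hγ : ContDiff ℝ (⊤ : ℕ∞) γ) : axS γ (utang γ) :=
  ax_S_aderiv hγ (fun _ _ => hγ.contDiffAt)

lemma ax_S_aderivP (hγ : ContDiff ℝ (⊤ : ℕ∞) γ) {f : ℝ → EuclideanSpace ℝ (Fin n)}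
    (hf : axS γ f) : axS γ (aderivP γ f) := by
  intro x hx
  have h1 := ax_S_aderiv hγ hf x hx
  have h2 := ax_S_utang hγ x hx
  exact h1.sub ((h1.inner ℝ h2).smul h2)

lemma ax_utang_unit {x : ℝ} (hx : deriv γ x ≠ 0) : ⟪utang γ x, utang γ x⟫ = 1 := by
  have : ‖deriv γ x‖ ≠ 0 := norm_ne_zero_iff.2 hx
  rw [real_inner_self_eq_norm_sq, utang, aderiv, norm_smul, norm_inv, norm_norm,
    inv_mul_cancel₀ this, one_pow]

lemma ax_nor_aderivP (f : ℝ → EuclideanSpace ℝ (Fin n)) : axNor γ (aderivP γ f) := by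
  intro x hx
  simp only [aderivP, nperp, inner_sub_left, real_inner_smul_left, ax_utang_unit hx]
  ring

lemma ax_nor_curvV (hγ : ContDiff ℝ (⊤ : ℕ∞) γ) : axNor γ (curvV γ) := by
  intro x hx
  have hopen : ∀ᶠ y in nhds x, deriv γ y ≠ 0 :=
    (ax_deriv hγ.contDiffAt).continuousAt.eventually_ne hx
  have hT : DifferentiableAt ℝ (utang γ) x := (ax_S_utang hγ x hx).differentiableAt (by simp)
  have h1 := hT.hasDerivAt.inner ℝ hT.hasDerivAt
  have h2 : HasDerivAt (fun y => ⟪utang γ y, utang γ y⟫) 0 x := by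
    refine (hasDerivAt_const x (1:ℝ)).congr_of_eventuallyEq ?_
    filter_upwards [hopen] with y hy using ax_utang_unit hy
  have h3 := h1.unique h2
  rw [real_inner_comm] at h3
  have h4 : ⟪deriv (utang γ) x, utang γ x⟫ = 0 := by
    have := real_inner_comm (deriv (utang γ) x) (utang γ x)
    linarith
  simp only [curvV, aderiv, real_inner_smul_left, h4, mul_zero]

lemma ax_inner_aderivP {f g : ℝ → EuclideanSpace ℝ (Fin n)} (hg : axNor γ g) {x : ℝ}
    (hx : deriv γ x ≠ 0) :
    ⟪aderivP γ f x, g x⟫ * ‖deriv γ x‖ = ⟪deriv f x, g x⟫ := by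
  have h : ‖deriv γ x‖ ≠ 0 := norm_ne_zero_iff.2 hx
  have h2 := hg x hx
  rw [real_inner_comm] at h2
  simp only [aderivP, nperp, inner_sub_left, real_inner_smul_left, h2]
  simp only [aderiv, real_inner_smul_left]
  field_simp
  ring

lemma ax_metric {f g : ℝ → EuclideanSpace ℝ (Fin n)}
    (hf : axS γ f) (hg : axS γ g) (nf : axNor γ f) (ng : axNor γ g) {x : ℝ}
    (hx : deriv γ x ≠ 0) :
    HasDerivAt (fun y => ⟪f y, g y⟫)
      (⟪aderivP γ f x, g x⟫ * ‖deriv γ x‖ + ⟪f x, aderivP γ g x⟫ * ‖deriv γ x‖) x := by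
  have h1 : DifferentiableAt ℝ f x := (hf x hx).differentiableAt (by simp)
  have h2 : DifferentiableAt ℝ g x := (hg x hx).differentiableAt (by simp)
  have h := h1.hasDerivAt.inner ℝ h2.hasDerivAt
  rw [real_inner_comm (aderivP γ g x), ax_inner_aderivP ng hx, ax_inner_aderivP nf hx,
    real_inner_comm (f x) (deriv g x), add_comm]
  exact h

lemma ax_S_iter (hγ : ContDiff ℝ (⊤ : ℕ∞) γ) (k : ℕ) :
    axS γ (aderivPIter γ k (curvV γ)) := by
  induction k with
  | zero => exact ax_S_aderiv hγ (ax_S_utang hγ)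
  | succ k ih => exact ax_S_aderivP hγ ih

lemma ax_nor_iter (hγ : ContDiff ℝ (⊤ : ℕ∞) γ) (k : ℕ) :
    axNor γ (aderivPIter γ k (curvV γ)) := by
  cases k with
  | zero => exact ax_nor_curvV hγ
  | succ k => exact ax_nor_aderivP _

end

/-- a priori estimate for the Lagrange multiplier (Lemma 4.4). -/
theorem statement9
    (n m : ℕ) (hn : 2 ≤ n) (L₀ δ : ℝ) (hL : 0 < L₀) (hδ : 0 < δ) :
    ∃ C : ℝ, 0 < C ∧
      ∀ γ : ℝ → EuclideanSpace ℝ (Fin n),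
        ContDiff ℝ (⊤ : ℕ∞) γ →
        (∀ x ∈ Icc (-1:ℝ) 1, deriv γ x ≠ 0) →
        elL γ = L₀ → δ < elE γ → elE γ < δ⁻¹ →
        |lagMul γ|
          ≤ C * (1 + l2ds γ (aderivPIter γ (m + 2) (curvV γ)) ^ ((2:ℝ) / (m + 2))) := by
  obtain ⟨C, hC, hint⟩ := ax_interp ((64 * (L₀⁻¹ + 2) ^ 2) ^ 2) (by positivity) m
  obtain ⟨D, hD⟩ : ∃ D, D = Real.sqrt δ⁻¹ := ⟨_, rfl⟩
  have hD0 : 0 < D := by rw [hD]; positivity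
  refine ⟨δ⁻¹ * (2 * D * (C * (D + 1)) + L₀⁻¹ * D ^ 4 + 2 * D ^ 3 * (C * (D + 1))),
    by positivity, ?_⟩
  intro γ hγ him hlen hE1 hE2
  set v : ℝ → ℝ := fun x => ‖deriv γ x‖ with hvdef
  set Φ : ℕ → ℝ → EuclideanSpace ℝ (Fin n) := fun k => aderivPIter γ k (curvV γ) with hΦ
  have hv : ContinuousOn v (Icc (-1:ℝ) 1) := fun x _ =>
    ((ax_deriv hγ.contDiffAt).continuousAt.norm).continuousWithinAt
  have hv0 : ∀ x ∈ Icc (-1:ℝ) 1, 0 ≤ v x := fun x _ => norm_nonneg _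
  have hcont : ∀ k, ContinuousOn (Φ k) (Icc (-1:ℝ) 1) := fun k x hx =>
    (ax_S_iter hγ k x (him x hx)).continuousAt.continuousWithinAt
  have hder : ∀ i j, ∀ x ∈ Icc (-1:ℝ) 1, HasDerivAt (fun y => ⟪Φ i y, Φ j y⟫)
      (⟪Φ (i+1) x, Φ j x⟫ * v x + ⟪Φ i x, Φ (j+1) x⟫ * v x) x := fun i j x hx =>
    ax_metric (ax_S_iter hγ i) (ax_S_iter hγ j) (ax_nor_iter hγ i) (ax_nor_iter hγ j) (him x hx)
  have hself : ∀ i, ∀ x ∈ Icc (-1:ℝ) 1, HasDerivAt (fun y => ⟪Φ i y, Φ i y⟫)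
      (2 * (⟪Φ (i+1) x, Φ i x⟫ * v x)) x := by
    intro i x hx
    have h := hder i i x hx
    rw [real_inner_comm (Φ (i+1) x) (Φ i x), ← two_mul] at h
    exact h
  set b : ℕ → ℝ := fun k => axN v (Φ k) with hb
  have hb0 : ∀ i, 0 ≤ b i := fun i => axN_nonneg _ _
  have hbi : ∀ i, b (i+1) ^ 2 ≤ (64 * (L₀⁻¹ + 2) ^ 2) ^ 2 * (b i * (b i + b (i+2))) := by
    intro i
    refine ax_step hL hv hv0 hlen (hcont i) (hcont (i+1)) (hcont (i+2)) (hself i) (hself (i+1)) ?_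
    intro x hx
    have h := hder i (i+1) x hx
    rw [real_inner_self_eq_norm_sq] at h
    exact h
  obtain ⟨r1, r2⟩ := hint b hb0 hbi
  have hbm : l2ds γ (aderivPIter γ (m + 2) (curvV γ)) = b (m+2) := rfl
  rw [hbm]
  have hX0 : 0 ≤ b (m+2) ^ ((2:ℝ) / (m + 2)) := Real.rpow_nonneg (hb0 _) _
  obtain ⟨X, hX⟩ : ∃ X, X = 1 + b (m+2) ^ ((2:ℝ) / (m + 2)) := ⟨_, rfl⟩
  rw [← hX] at r1 r2 ⊢
  have hX1 : 1 ≤ X := by rw [hX]; linarith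
  have hEb : b 0 ^ 2 = elE γ := axN_sq hv0
  have hbD : b 0 ≤ D := by
    rw [hD]; apply Real.le_sqrt_of_sq_le; rw [hEb]; exact hE2.le
  have hsup := ax_sup hL hv hv0 hlen (hcont 0) (hcont 1) (hself 0)
  have i1 : IntervalIntegrable (fun x => ⟪Φ 2 x, Φ 0 x⟫ * v x) volume (-1) 1 :=
    ax_int (((hcont 2).inner (hcont 0)).mul hv)
  have i2 : IntervalIntegrable (fun x => ‖Φ 0 x‖ ^ 2 * (‖Φ 0 x‖ ^ 2 * v x)) volume (-1) 1 :=
    ax_int ((((hcont 0).norm).pow 2).mul ((((hcont 0).norm).pow 2).mul hv))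
  have i3 : IntervalIntegrable (fun x => ‖Φ 0 x‖ ^ 2 * v x) volume (-1) 1 :=
    ax_int ((((hcont 0).norm).pow 2).mul hv)
  have hnum : ∫ x in (-1:ℝ)..1, ⟪gradElE γ x, curvV γ x⟫ * ‖deriv γ x‖
      = 2 * (∫ x in (-1:ℝ)..1, ⟪Φ 2 x, Φ 0 x⟫ * v x)
        + ∫ x in (-1:ℝ)..1, ‖Φ 0 x‖ ^ 2 * (‖Φ 0 x‖ ^ 2 * v x) := by
    rw [← intervalIntegral.integral_const_mul, ← intervalIntegral.integral_add
      (i1.const_mul 2) i2]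
    congr 1
    funext x
    have e0 : Φ 0 x = curvV γ x := rfl
    rw [← e0]
    simp only [gradElE, inner_add_left, real_inner_smul_left]
    rw [← e0, real_inner_self_eq_norm_sq]
    simp only [hΦ, hvdef]
    ring
  have q1 : |∫ x in (-1:ℝ)..1, ⟪Φ 2 x, Φ 0 x⟫ * v x| ≤ b 2 * b 0 :=
    ax_inner' hv hv0 (hcont 2) (hcont 0)
  have q2 : ∫ x in (-1:ℝ)..1, ‖Φ 0 x‖ ^ 2 * (‖Φ 0 x‖ ^ 2 * v x)
      ≤ (L₀⁻¹ * b 0 ^ 2 + 2 * b 0 * b 1) * b 0 ^ 2 := by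
    have hsq : b 0 ^ 2 = ∫ x in (-1:ℝ)..1, ‖Φ 0 x‖ ^ 2 * v x := axN_sq hv0
    rw [hsq, ← intervalIntegral.integral_const_mul, ← hsq]
    apply intervalIntegral.integral_mono_on (by norm_num) i2 (i3.const_mul _)
    intro x hx
    exact mul_le_mul_of_nonneg_right (hsup x hx) (mul_nonneg (sq_nonneg _) (hv0 x hx))
  have q3 : 0 ≤ ∫ x in (-1:ℝ)..1, ‖Φ 0 x‖ ^ 2 * (‖Φ 0 x‖ ^ 2 * v x) :=
    intervalIntegral.integral_nonneg (by norm_num) fun x hx =>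
      mul_nonneg (sq_nonneg _) (mul_nonneg (sq_nonneg _) (hv0 x hx))
  have p0 := hb0 0
  have p1 := hb0 1
  have p2 := hb0 2
  have hCD : C * (b 0 + 1) * X ≤ C * (D + 1) * X := by gcongr
  have t1 : b 2 * b 0 ≤ C * (D + 1) * X * D := mul_le_mul (r2.trans hCD) hbD p0 (by positivity)
  have t2 : (L₀⁻¹ * b 0 ^ 2 + 2 * b 0 * b 1) * b 0 ^ 2
      ≤ (L₀⁻¹ * D ^ 2 * X + 2 * D * (C * (D + 1) * X)) * D ^ 2 := by
    have u1 : L₀⁻¹ * b 0 ^ 2 ≤ L₀⁻¹ * D ^ 2 * X := by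
      have : L₀⁻¹ * b 0 ^ 2 ≤ L₀⁻¹ * D ^ 2 := by gcongr
      exact this.trans (le_mul_of_one_le_right (by positivity) hX1)
    have u2 : 2 * b 0 * b 1 ≤ 2 * D * (C * (D + 1) * X) := by
      have := r1.trans hCD
      gcongr
    gcongr
  have habs : |∫ x in (-1:ℝ)..1, ⟪gradElE γ x, curvV γ x⟫ * ‖deriv γ x‖|
      ≤ (2 * D * (C * (D + 1)) + L₀⁻¹ * D ^ 4 + 2 * D ^ 3 * (C * (D + 1))) * X := by
    rw [hnum]
    have q1' := abs_le.1 q1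
    have : (2 * D * (C * (D + 1)) + L₀⁻¹ * D ^ 4 + 2 * D ^ 3 * (C * (D + 1))) * X
      = 2 * (C * (D + 1) * X * D)
        + (L₀⁻¹ * D ^ 2 * X + 2 * D * (C * (D + 1) * X)) * D ^ 2 := by ring
    rw [this, abs_le]
    constructor <;> linarith [q1'.1, q1'.2]
  have hE0 : 0 < elE γ := hδ.trans hE1
  rw [lagMul, abs_div, abs_of_pos hE0, div_le_iff₀ hE0]
  refine habs.trans ?_
  have hY : 0 ≤ (2 * D * (C * (D + 1)) + L₀⁻¹ * D ^ 4 + 2 * D ^ 3 * (C * (D + 1))) * X := by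
    positivity
  have h1 : 1 ≤ δ⁻¹ * elE γ := by
    rw [inv_mul_eq_div, one_le_div hδ]; exact hE1.le
  calc _ ≤ (2 * D * (C * (D + 1)) + L₀⁻¹ * D ^ 4 + 2 * D ^ 3 * (C * (D + 1))) * X
        * (δ⁻¹ * elE γ) := le_mul_of_one_le_right hY h1
    _ = _ := by ring

end
end
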